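/- The function Φ(ν) = a²·e^{ν}(e^{Ξ⁻¹(ν)} − e^{ν}) is strictly decreasing on the interval [−1, ∞); moreover Φ(0) = 0 and 0 < Φ(−1) < a². -/

import Mathlib

noncomputable def Xi (ζ : ℝ) : ℝ := Real.exp (-ζ/2) - Real.exp (ζ/2)

noncomputable def XiInv : ℝ → ℝ := Function.invFun Xi

noncomputable def Phi (a ν : ℝ) : ℝ := a^2 * Real.exp ν * (Real.exp (XiInv ν) - Real.exp ν)

theorem Xi_eq_sinh (ζ : ℝ) : Xi ζ = -2 * Real.sinh (ζ / 2) := by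
  rw [Xi, Real.sinh_eq, neg_div]
  ring

theorem Xi_injective : Function.Injective Xi := by
  intro x y h
  simp only [Xi_eq_sinh] at h
  have := Real.sinh_injective (by linarith : Real.sinh (x / 2) = Real.sinh (y / 2))
  linarith

theorem XiInv_eq_arsinh (ν : ℝ) : XiInv ν = -2 * Real.arsinh (ν / 2) := by
  have h : Xi (-2 * Real.arsinh (ν / 2)) = ν := by
    rw [Xi_eq_sinh, show -2 * Real.arsinh (ν / 2) / 2 = -Real.arsinh (ν / 2) by ring,
      Real.sinh_neg, Real.sinh_arsinh]
    ring
  apply Xi_injective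
  rw [h]
  exact Function.invFun_eq ⟨_, h⟩

theorem Phi_eq_arsinh (a ν : ℝ) :
    Phi a ν = a ^ 2 * (Real.exp (ν - 2 * Real.arsinh (ν / 2)) - Real.exp (2 * ν)) := by
  rw [Phi, XiInv_eq_arsinh, sub_eq_add_neg ν, Real.exp_add, two_mul ν, Real.exp_add,
    neg_mul]
  ring

theorem hasDerivAt_Phi (a ν : ℝ) :
    HasDerivAt (Phi a) (a ^ 2 * (Real.exp (ν - 2 * Real.arsinh (ν / 2)) *
      (1 - (√(1 + (ν / 2) ^ 2))⁻¹) - 2 * Real.exp (2 * ν))) ν := by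
  rw [funext (Phi_eq_arsinh a)]
  have hs := ((hasDerivAt_id ν).div_const 2).arsinh
  have h1 := ((hasDerivAt_id ν).sub (hs.const_mul 2)).exp
  have h2 := ((hasDerivAt_id ν).const_mul 2).exp
  refine ((h1.sub h2).const_mul (a ^ 2)).congr_deriv ?_
  simp only [id, smul_eq_mul, Pi.sub_apply]
  ring

theorem exp_neg_two_mul_arsinh (t : ℝ) :
    Real.exp (-(2 * Real.arsinh t)) = (-t + √(1 + t ^ 2)) ^ 2 := by
  rw [← mul_neg, ← Real.arsinh_neg, two_mul, Real.exp_add, Real.exp_arsinh, neg_sq, ← sq]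

theorem exp_neg_two_mul_arsinh_mul_lt {ν : ℝ} (hν : -1 ≤ ν) :
    Real.exp (-(2 * Real.arsinh (ν / 2))) * (1 - (√(1 + (ν / 2) ^ 2))⁻¹) <
      2 * Real.exp ν := by
  have hr1 : 1 ≤ √(1 + (ν / 2) ^ 2) := Real.one_le_sqrt.2 (by nlinarith [sq_nonneg (ν / 2)])
  have hi : 0 < (√(1 + (ν / 2) ^ 2))⁻¹ := by positivity
  rcases le_or_gt 0 ν with h | h
  · have hs : 0 ≤ Real.arsinh (ν / 2) := Real.arsinh_nonneg_iff.2 (by linarith)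
    have he : Real.exp (-(2 * Real.arsinh (ν / 2))) ≤ 1 := Real.exp_le_one_iff.2 (by linarith)
    have := Real.exp_pos (-(2 * Real.arsinh (ν / 2)))
    have := Real.one_le_exp h
    nlinarith
  · have hr2 : √(1 + (ν / 2) ^ 2) ≤ 9 / 8 :=
      Real.sqrt_le_iff.2 ⟨by norm_num, by nlinarith⟩
    have hi2 : 8 / 9 ≤ (√(1 + (ν / 2) ^ 2))⁻¹ := by
      rw [le_inv_comm₀ (by norm_num) (by linarith)]
      linarith
    have he : Real.exp (-(2 * Real.arsinh (ν / 2))) ≤ 3 := by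
      rw [exp_neg_two_mul_arsinh]
      nlinarith
    have h1 : Real.exp (-1) ≤ Real.exp ν := Real.exp_le_exp.2 hν
    have := Real.exp_neg_one_gt_d9
    have := Real.exp_pos (-(2 * Real.arsinh (ν / 2)))
    nlinarith

theorem Phi_strictAntiOn {a : ℝ} (ha : 0 < a) : StrictAntiOn (Phi a) (Set.Ici (-1)) := by
  refine strictAntiOn_of_deriv_neg (convex_Ici _)
    (fun ν _ => (hasDerivAt_Phi a ν).continuousAt.continuousWithinAt) fun ν hν => ?_
  rw [interior_Ici, Set.mem_Ioi] at hν
  rw [(hasDerivAt_Phi a ν).deriv, sub_eq_add_neg ν, Real.exp_add, two_mul ν, Real.exp_add]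
  have h := mul_lt_mul_of_pos_left (exp_neg_two_mul_arsinh_mul_lt hν.le) (Real.exp_pos ν)
  exact mul_neg_of_pos_of_neg (by positivity) (by linarith)

theorem Phi_zero (a : ℝ) : Phi a 0 = 0 := by
  simp [Phi_eq_arsinh]

theorem Phi_neg_one_lt {a : ℝ} (ha : 0 < a) : Phi a (-1) < a ^ 2 := by
  have hr : √(1 + (-1 / 2 : ℝ) ^ 2) ≤ 9 / 8 := Real.sqrt_le_iff.2 ⟨by norm_num, by norm_num⟩
  have hr0 := Real.sqrt_nonneg (1 + (-1 / 2 : ℝ) ^ 2)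
  have hw : Real.exp (-(2 * Real.arsinh (-1 / 2))) ≤ 2.65 := by
    rw [exp_neg_two_mul_arsinh]
    nlinarith
  rw [Phi, XiInv_eq_arsinh, neg_mul, mul_assoc]
  have h1 := Real.exp_neg_one_gt_d9
  have h2 := Real.exp_neg_one_lt_d9
  refine mul_lt_of_lt_one_right (by positivity) ?_
  nlinarith

theorem Phi_strictAnti_and_values (a : ℝ) (ha : 0 < a) :
    StrictAntiOn (Phi a) (Set.Ici (-1)) ∧
    Phi a 0 = 0 ∧ 0 < Phi a (-1) ∧ Phi a (-1) < a^2 := by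
  refine ⟨Phi_strictAntiOn ha, Phi_zero a, ?_, Phi_neg_one_lt ha⟩
  rw [← Phi_zero a]
  exact Phi_strictAntiOn ha (by simp) (by simp) (by norm_num)
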